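/- arXiv:0803.0477 — 2 statements merged into one kernel-verified Lean document; each statement's English description precedes it below -/
import Mathlib

section
/- For every positive integer k, the minimal binary Niven number a_k satisfies 2^k − 1 ≤ a_k ≤ 2^{k + n_k} − 2^{μ₂(k)}. -/
/-- `binDigitSum n` is the sum of the binary digits of `n`. -/
def binDigitSum (n : ℕ) : ℕ := (Nat.digits 2 n).sum

theorem binDigitSum_eq_mod_add_div (n : ℕ) : binDigitSum n = n % 2 + binDigitSum (n / 2) := by
  rcases Nat.eq_zero_or_pos n with rfl | hn
  · simp [binDigitSum]
  · simp [binDigitSum, Nat.digits_def' one_lt_two hn]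

theorem binDigitSum_two_mul (n : ℕ) : binDigitSum (2 * n) = binDigitSum n := by
  rw [binDigitSum_eq_mod_add_div]
  simp

theorem binDigitSum_two_pow_mul (j n : ℕ) : binDigitSum (2 ^ j * n) = binDigitSum n := by
  induction j with
  | zero => simp
  | succ j ih => rw [pow_succ', mul_assoc, binDigitSum_two_mul, ih]

theorem two_pow_binDigitSum_le (n : ℕ) : 2 ^ binDigitSum n ≤ n + 1 := by
  induction n using Nat.strong_induction_on with
  | _ n ih =>
    rcases Nat.eq_zero_or_pos n with rfl | hn
    · simp [binDigitSum]
    · have h := ih (n / 2) (by omega)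
      rw [binDigitSum_eq_mod_add_div, pow_add]
      rcases Nat.mod_two_eq_zero_or_one n with h2 | h2 <;> rw [h2] <;> omega

theorem binDigitSum_two_pow_add {L x : ℕ} (hx : x < 2 ^ L) :
    binDigitSum (2 ^ L + x) = binDigitSum x + 1 := by
  induction L generalizing x with
  | zero =>
    obtain rfl : x = 0 := by simpa using hx
    simp [binDigitSum]
  | succ L ih =>
    rw [pow_succ] at hx ⊢
    have h := ih (x := x / 2) (by omega)
    rw [binDigitSum_eq_mod_add_div, binDigitSum_eq_mod_add_div x,
      show (2 ^ L * 2 + x) / 2 = 2 ^ L + x / 2 by omega,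
      show (2 ^ L * 2 + x) % 2 = x % 2 by omega, h]
    omega

theorem binDigitSum_sum_two_pow (S : Finset ℕ) : binDigitSum (∑ i ∈ S, 2 ^ i) = S.card := by
  induction S using Finset.induction_on_max with
  | empty => simp [binDigitSum]
  | insert a S hS ih =>
    have ha : a ∉ S := fun h => (hS a h).false
    rw [Finset.sum_insert ha, Finset.card_insert_of_notMem ha,
      binDigitSum_two_pow_add (Nat.geomSum_lt le_rfl hS), ih]

/-- An odd `m` admits an exponent `D < m` with `2 ^ D ≡ 1` modulo `m` that is not too small. -/
theorem exists_two_pow_modEq_one {m : ℕ} (hm : Odd m) :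
    ∃ D, D + 1 ≤ m ∧ m ≤ 2 ^ (D + 1) ∧ 2 ^ D ≡ 1 [MOD m] := by
  have hpos := hm.pos
  have hφ : 2 ^ m.totient ≡ 1 [MOD m] :=
    Nat.ModEq.pow_totient (Nat.coprime_two_left.mpr hm)
  rcases eq_or_ne m 1 with rfl | h1
  · exact ⟨0, by simp [Nat.ModEq]⟩
  have hlt : m.totient < m := Nat.totient_lt m (by omega)
  have hφ0 : 0 < m.totient := Nat.totient_pos.mpr hpos
  have hdiv := Nat.div_add_mod (m - 1) m.totient
  have hmod := Nat.mod_lt (m - 1) hφ0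
  have hle : m.totient ≤ m.totient * ((m - 1) / m.totient) :=
    Nat.le_mul_of_pos_right _ (Nat.div_pos (by omega) hφ0)
  refine ⟨m.totient * ((m - 1) / m.totient), by omega, ?_, ?_⟩
  · have := Nat.lt_two_pow_self (n := m.totient * ((m - 1) / m.totient))
    rw [pow_succ]
    omega
  · rw [pow_mul]
    simpa using hφ.pow ((m - 1) / m.totient)

/-- Modulo `m`, every sum `2 ^ n - 1 + r` with `r < 2 ^ n` is a sum of `n` powers of `2` with
distinct exponents below `D + n + 1`, as soon as `2 ^ D ≡ 1` and `n ≤ D + 1`. -/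
theorem exists_card_sum_two_pow_modEq {m n D r : ℕ} (hD : 2 ^ D ≡ 1 [MOD m]) (hn : n ≤ D + 1)
    (hr : r < 2 ^ n) :
    ∃ Z ⊆ Finset.range (D + n + 1), Z.card = n ∧ ∑ i ∈ Z, 2 ^ i ≡ 2 ^ n - 1 + r [MOD m] := by
  set T := r.bitIndices.toFinset with hT
  have hsum : ∑ i ∈ T, 2 ^ i = r := Finset.sum_toFinset_bitIndices_two_pow r
  have hTn : T ⊆ Finset.range n := fun i hi => by
    have h1 : 2 ^ i ≤ r := hsum ▸
      Finset.single_le_sum (f := fun i => 2 ^ i) (fun _ _ => Nat.zero_le _) hi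
    exact Finset.mem_range.mpr ((Nat.pow_lt_pow_iff_right one_lt_two).mp (h1.trans_lt hr))
  let f : ℕ → ℕ := fun i => if i ∈ T then D + 1 + i else i
  have hinj : Set.InjOn f (Finset.range n) := by
    intro i hi j hj hij
    simp only [Finset.coe_range, Set.mem_Iio] at hi hj
    simp only [f] at hij
    split_ifs at hij <;> omega
  refine ⟨(Finset.range n).image f, ?_, ?_, ?_⟩
  · intro x hx
    obtain ⟨i, hi, rfl⟩ := Finset.mem_image.mp hx
    rw [Finset.mem_range] at hi ⊢
    simp only [f]
    split_ifs <;> omega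
  · rw [Finset.card_image_of_injOn hinj, Finset.card_range]
  · rw [Finset.sum_image hinj]
    have hterm : ∀ i, 2 ^ f i ≡ 2 ^ i + (if i ∈ T then 2 ^ i else 0) [MOD m] := by
      intro i
      simp only [f]
      split_ifs with h
      · have := hD.mul_right (2 ^ (i + 1))
        rwa [← pow_add, one_mul, pow_succ 2 i, mul_two, show D + (i + 1) = D + 1 + i by ring]
          at this
      · exact Nat.ModEq.rfl
    have hgeom : ∑ i ∈ Finset.range n, 2 ^ i = 2 ^ n - 1 := by
      simpa using Nat.geomSum_eq (le_refl 2) n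
    have hrest : ∑ i ∈ Finset.range n, (if i ∈ T then 2 ^ i else 0) = r := by
      rw [Finset.sum_ite_mem, Finset.inter_eq_right.mpr hTn, hsum]
    rw [← hgeom, ← hrest, ← Finset.sum_add_distrib]
    exact Nat.ModEq.sum fun i _ => hterm i

theorem exists_multiple_binDigitSum_eq {m n K : ℕ} (hm : Odd m) (hmn : m ≤ 2 ^ n) (hK : m ≤ K) :
    ∃ M, m ∣ M ∧ binDigitSum M = K ∧ M < 2 ^ (K + n) := by
  wlog hn : n = Nat.clog 2 m generalizing n
  · obtain ⟨M, h1, h2, h3⟩ := this (Nat.le_pow_clog one_lt_two m) rfl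
    refine ⟨M, h1, h2, h3.trans_le (Nat.pow_le_pow_right two_pos ?_)⟩
    have := Nat.clog_le_of_le_pow hmn
    omega
  obtain ⟨D, hDm, hmD, hD⟩ := exists_two_pow_modEq_one hm
  have hnD : n ≤ D + 1 := hn ▸ Nat.clog_le_of_le_pow hmD
  obtain ⟨Z, hZ, hcard, hsum⟩ := exists_card_sum_two_pow_modEq (r := (2 ^ (K + n) - 2 ^ n) % m)
    hD hnD ((Nat.mod_lt _ hm.pos).trans_le hmn)
  have hZ' : Z ⊆ Finset.range (K + n) :=
    hZ.trans (Finset.range_subset_range.mpr (by omega))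
  refine ⟨∑ i ∈ Finset.range (K + n) \ Z, 2 ^ i, ?_, ?_, ?_⟩
  · have hgeom : ∑ i ∈ Finset.range (K + n), 2 ^ i = 2 ^ (K + n) - 1 := by
      simpa using Nat.geomSum_eq (le_refl 2) (K + n)
    have hsplit := Finset.sum_sdiff (f := fun i => 2 ^ i) hZ'
    have hpow : 2 ^ n ≤ 2 ^ (K + n) := Nat.pow_le_pow_right two_pos (by omega)
    have hn1 := Nat.one_le_two_pow (n := n)
    have htotal : ∑ i ∈ Z, 2 ^ i ≡ 2 ^ (K + n) - 1 [MOD m] := by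
      have := hsum.trans ((Nat.mod_modEq (2 ^ (K + n) - 2 ^ n) m).add_left (2 ^ n - 1))
      rwa [show 2 ^ n - 1 + (2 ^ (K + n) - 2 ^ n) = 2 ^ (K + n) - 1 by omega] at this
    rw [← hgeom, ← hsplit] at htotal
    exact (Nat.modEq_zero_iff_dvd).mp
      (Nat.ModEq.add_right_cancel' (∑ i ∈ Z, 2 ^ i) (by simpa using htotal.symm))
  · rw [binDigitSum_sum_two_pow, Finset.card_sdiff_of_subset hZ', hcard, Finset.card_range]
    omega
  · exact Nat.geomSum_lt le_rfl fun i hi => Finset.mem_range.mp (Finset.mem_sdiff.mp hi).1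

/-- Corollary 4 of the paper: the minimal binary Niven number `a_k` (the smallest
positive multiple of `k` whose binary digit sum is `k`) satisfies
`2^k - 1 ≤ a_k ≤ 2^(k + n_k) - 2^(μ₂(k))`, where `n_k` is the smallest positive
integer with `k ≤ 2^(n_k)` and `μ₂(k)` is the exponent of `2` in `k`. -/
theorem minimal_binary_niven_bounds
    (k : ℕ) (hk : 0 < k)
    (a : ℕ) (ha : IsLeast {N : ℕ | 0 < N ∧ k ∣ N ∧ binDigitSum N = k} a)
    (nk : ℕ) (hnk : IsLeast {n : ℕ | 0 < n ∧ k ≤ 2 ^ n} nk) :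
    2 ^ k - 1 ≤ a ∧ a ≤ 2 ^ (k + nk) - 2 ^ (padicValNat 2 k) := by
  obtain ⟨⟨-, -, hsum⟩, hmin⟩ := ha
  refine ⟨?_, ?_⟩
  · have := two_pow_binDigitSum_le a
    rw [hsum] at this
    omega
  · obtain ⟨μ, m, hm, hkm⟩ := Nat.exists_eq_two_pow_mul_odd hk.ne'
    have hμ : padicValNat 2 k = μ := by
      rw [hkm, padicValNat.mul (by positivity) hm.pos.ne', padicValNat.prime_pow,
        padicValNat.eq_zero_of_not_dvd hm.not_two_dvd_nat, add_zero]
    have hknk : k ≤ 2 ^ nk := hnk.1.2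
    have hμnk : μ ≤ nk := (Nat.pow_le_pow_iff_right one_lt_two).mp
      ((Nat.le_of_dvd hk ⟨m, hkm⟩).trans hknk)
    have hsplit : 2 ^ nk = 2 ^ μ * 2 ^ (nk - μ) := by rw [← pow_add, Nat.add_sub_cancel' hμnk]
    have hmn : m ≤ 2 ^ (nk - μ) := by
      rw [hkm, hsplit] at hknk
      exact Nat.le_of_mul_le_mul_left hknk (by positivity)
    obtain ⟨M, hdvd, hM, hlt⟩ := exists_multiple_binDigitSum_eq hm hmn
      (Nat.le_of_dvd hk ⟨2 ^ μ, by rw [hkm, mul_comm]⟩)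
    have hM0 : 0 < M := by
      rcases Nat.eq_zero_or_pos M with rfl | h
      · simp [binDigitSum] at hM
        omega
      · exact h
    have hmem : 2 ^ μ * M ∈ {N : ℕ | 0 < N ∧ k ∣ N ∧ binDigitSum N = k} :=
      ⟨by positivity, by rw [hkm]; exact mul_dvd_mul_left _ hdvd,
        by rw [binDigitSum_two_pow_mul, hM]⟩
    calc a ≤ 2 ^ μ * M := hmin hmem
      _ ≤ 2 ^ μ * (2 ^ (k + (nk - μ)) - 1) := Nat.mul_le_mul_left _ (by omega)
      _ = 2 ^ (k + nk) - 2 ^ padicValNat 2 k := by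
        rw [hμ, Nat.mul_sub, mul_one, ← pow_add, show μ + (k + (nk - μ)) = k + nk by omega]
end

section
/- Let i ≥ 2 be an integer and k = 2^i − 1 ≥ 3, and let k⁻ denote the least positive residue of −k modulo i (so 1 ≤ k⁻ ≤ i − 1; note i does not divide k). Then the number N = 2^{k + k⁻} + 2^k − 2^{k−i} − 1 is divisible by k and its binary digit sum equals k, i.e., s(N) = k. -/
theorem binDigitSum_two_mul_add_one (n : ℕ) :
    binDigitSum (2 * n + 1) = binDigitSum n + 1 := by
  simp only [binDigitSum, Nat.digits_def' one_lt_two (Nat.succ_pos (2 * n)), List.sum_cons]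
  rw [show (2 * n + 1) / 2 = n by lia, show (2 * n + 1) % 2 = 1 by lia, add_comm]

theorem binDigitSum_two_pow (m : ℕ) : binDigitSum (2 ^ m) = 1 := by
  induction m with
  | zero => simp [binDigitSum]
  | succ m ih => rw [pow_succ', binDigitSum_two_mul, ih]

/-- Appending `m` binary ones to `b` raises its binary digit sum by `m`. -/
theorem binDigitSum_two_pow_sub_one_add (m b : ℕ) :
    binDigitSum (2 ^ m - 1 + 2 ^ m * b) = m + binDigitSum b := by
  induction m with
  | zero => simp
  | succ m ih =>
    have hpos : 0 < 2 ^ m := by positivity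
    have h : 2 ^ (m + 1) - 1 + 2 ^ (m + 1) * b = 2 * (2 ^ m - 1 + 2 ^ m * b) + 1 := by
      rw [pow_succ', mul_assoc]
      lia
    rw [h, binDigitSum_two_mul_add_one, ih]
    ring

/-- Let `i ≥ 2`, `k = 2^i - 1 ≥ 3`, and let `km` be the least positive residue of
`-k` modulo `i` (so `1 ≤ km ≤ i - 1` and `i ∣ km + k`).  Then
`N = 2^(k + km) + 2^k - 2^(k-i) - 1` is divisible by `k` and its binary digit sum
equals `k`. -/
theorem mersenne_candidate_is_niven
    (i k km : ℕ) (hi : 2 ≤ i) (hk : k = 2 ^ i - 1)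
    (hkm1 : 1 ≤ km) (hkm2 : km ≤ i - 1) (hkm3 : i ∣ km + k) :
    k ∣ (2 ^ (k + km) + 2 ^ k - 2 ^ (k - i) - 1) ∧
    binDigitSum (2 ^ (k + km) + 2 ^ k - 2 ^ (k - i) - 1) = k := by
  have hik : i ≤ k := by
    have := Nat.lt_two_pow_self (n := i)
    lia
  obtain ⟨d, rfl⟩ := Nat.exists_eq_add_of_le hik
  obtain ⟨j, rfl⟩ := Nat.exists_eq_add_of_le' (one_le_two.trans hi)
  have hd : 0 < 2 ^ d := by positivity
  have hj : 0 < 2 ^ j := by positivity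
  rw [Nat.add_sub_cancel_left]
  constructor
  · have hsplit : 2 ^ (j + 1 + d + km) + 2 ^ (j + 1 + d) - 2 ^ d - 1 =
        (2 ^ (km + (j + 1 + d)) - 1) + 2 ^ d * (2 ^ (j + 1) - 1) := by
      have hpos : 0 < 2 ^ (km + (j + 1 + d)) := by positivity
      have hle : 2 ^ d ≤ 2 ^ d * 2 ^ (j + 1) := Nat.le_mul_of_pos_right _ (by positivity)
      rw [add_comm (j + 1 + d) km, Nat.mul_sub_one, pow_add 2 (j + 1) d,
        mul_comm (2 ^ (j + 1))]
      lia
    rw [hsplit, hk]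
    exact dvd_add (Nat.pow_sub_one_dvd_pow_sub_one 2 (by rwa [← hk])) (dvd_mul_left _ _)
  · have hsplit : 2 ^ (j + 1 + d + km) + 2 ^ (j + 1 + d) - 2 ^ d - 1 =
        2 ^ d - 1 + 2 ^ d * (2 * (2 ^ j - 1 + 2 ^ j * 2 ^ km)) := by
      obtain ⟨a, ha⟩ := Nat.exists_eq_add_of_le' hj
      obtain ⟨b, hb⟩ := Nat.exists_eq_add_of_le' hd
      simp only [pow_add, pow_one, ha, hb, Nat.add_sub_cancel]
      rw [Nat.sub_sub, Nat.sub_eq_iff_eq_add (by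
        nlinarith [Nat.zero_le (a * b), Nat.zero_le ((a + 1) * 2 * (b + 1) * 2 ^ km)])]
      ring
    rw [hsplit, binDigitSum_two_pow_sub_one_add, binDigitSum_two_mul,
      binDigitSum_two_pow_sub_one_add, binDigitSum_two_pow]
    ring
end
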